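/- Let Q* be the quadrilateral with vertices (0, 5/4), (1/6, 7/6), (0, 1) and (−1/6, 7/6). Then: (a) every centrally symmetric convex decagon centered at the origin whose set of edge midpoints is D₂ has at least one vertex lying in the interior of Q*; and (b) for every point v in the interior of Q* there exists a centrally symmetric convex decagon centered at the origin whose set of edge midpoints is D₂ and which has v as one of its vertices. -/

import Mathlib

open Set Pointwise

noncomputable section

/-- A point of the plane `ℝ²`. -/
abbrev Pt : Type := ℝ × ℝ

/-- The standard integer lattice `ℤ² ⊆ ℝ²`. -/
def IntLattice : Set Pt := {p : Pt | ∃ a b : ℤ, p = ((a : ℝ), (b : ℝ))}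

/-- A lattice in `ℝ²` is the image of `ℤ²` under an invertible linear map. -/
def IsLattice (L : Set Pt) : Prop :=
  ∃ B : Pt ≃ₗ[ℝ] Pt, L = B '' IntLattice

/-- `K + L` is a `k`-fold lattice tiling of the plane: `L` is a lattice, every point lies in
at least `k` translates `K + l` (`l ∈ L`), and every point lies in at most `k` translates
`interior K + l`. -/
def IsKFoldLatticeTiling (K L : Set Pt) (k : ℕ) : Prop :=
  IsLattice L ∧
  (∀ p : Pt, (k : ℕ∞) ≤ {l ∈ L | p - l ∈ K}.encard) ∧
  (∀ p : Pt, {l ∈ L | p - l ∈ interior K}.encard ≤ (k : ℕ∞))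

/-- A discrete multiset of points of the plane, given as a family `x : I → ℝ²`:
every bounded set contains `x i` for only finitely many indices. -/
def IsDiscreteFamily {I : Type} (x : I → Pt) : Prop :=
  ∀ B : Set Pt, Bornology.IsBounded B → {i : I | x i ∈ B}.Finite

/-- `K + X` is a `k`-fold translative tiling of the plane, for the discrete multiset
`X = (x i)_{i ∈ I}`: every point lies in `K + x i` for at least `k` indices, and in
`interior K + x i` for at most `k` indices. -/
def IsKFoldTranslativeTiling {I : Type} (K : Set Pt) (x : I → Pt) (k : ℕ) : Prop :=
  IsDiscreteFamily x ∧
  (∀ p : Pt, (k : ℕ∞) ≤ {i : I | p - x i ∈ K}.encard) ∧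
  (∀ p : Pt, {i : I | p - x i ∈ interior K}.encard ≤ (k : ℕ∞))

/-- A convex polygon with exactly `n` vertices: a compact convex set with nonempty interior
which is the convex hull of its finitely many (`n`) extreme points. -/
def IsConvexPolygon (P : Set Pt) (n : ℕ) : Prop :=
  Convex ℝ P ∧ IsCompact P ∧ (interior P).Nonempty ∧
  (Set.extremePoints ℝ P).Finite ∧ (Set.extremePoints ℝ P).ncard = n ∧
  P = convexHull ℝ (Set.extremePoints ℝ P)

/-- `[a, b]` is an edge of the polygon `P`: a nondegenerate segment which is an extreme
(face) subset of `P`. -/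
def IsEdgeOf (P : Set Pt) (a b : Pt) : Prop :=
  a ≠ b ∧ IsExtreme ℝ P (segment ℝ a b)

/-- The set of midpoints of the edges of `P`. -/
def edgeMidpoints (P : Set Pt) : Set Pt :=
  {u : Pt | ∃ a b : Pt, IsEdgeOf P a b ∧ u = midpoint ℝ a b}

/-- `P` is centrally symmetric (about some center `c`). -/
def CentrallySymmetric (P : Set Pt) : Prop :=
  ∃ c : Pt, ∀ x : Pt, x ∈ P ↔ c + c - x ∈ P

/-- `D` is a parallelogram. -/
def IsParallelogram (D : Set Pt) : Prop :=
  ∃ v a b : Pt, LinearIndependent ℝ ![a, b] ∧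
    D = convexHull ℝ ({v, v + a, v + b, v + a + b} : Set Pt)

/-- The octagon `P₈(α)`, with vertices `±(α−1, 2), ±(α, −2), ±(1−α, 0), ±(1+α, −1)`. -/
def P8 (α : ℝ) : Set Pt :=
  convexHull ℝ ({(α - 1, 2), (α, -2), (1 - α, 0), (1 + α, -1),
                 (1 - α, -2), (-α, 2), (α - 1, 0), (-(1 + α), 1)} : Set Pt)

/-- The ten points `D₁`. -/
def D1 : Set Pt :=
  {(-1, 1/2), (1/2, 1), (3/2, 1), (2, 1/2), (2, 0),
   (1, -1/2), (-1/2, -1), (-3/2, -1), (-2, -1/2), (-2, 0)}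

/-- The ten points `D₂`. -/
def D2 : Set Pt :=
  {(1/2, -1), (3/2, -1/2), (2, 0), (3/2, 1/2), (1/2, 1),
   (-1/2, 1), (-3/2, 1/2), (-2, 0), (-3/2, -1/2), (-1/2, -1)}

/-- The set `(1/2)Λ = {λ/2 : λ ∈ Λ}`. -/
def halfSet (L : Set Pt) : Set Pt := (fun l : Pt => (2⁻¹ : ℝ) • l) '' L

/-- A cyclic enumeration `v : ZMod n → ℝ²` of the vertices of a convex polygon `P` with `n`
vertices: `v` is injective, its range is the vertex set of `P`, and consecutive vertices are
joined by edges of `P`. -/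
def IsCyclicVertexEnum (P : Set Pt) (n : ℕ) (v : ZMod n → Pt) : Prop :=
  Function.Injective v ∧ Set.range v = Set.extremePoints ℝ P ∧
  ∀ i : ZMod n, IsEdgeOf P (v i) (v (i + 1))

/-- The quadrilateral `Q*` of Theorem 2. -/
def Qstar : Set Pt :=
  convexHull ℝ ({(0, 5/4), (1/6, 7/6), (0, 1), (-1/6, 7/6)} : Set Pt)


/-- Evaluation of the linear functional with coefficients `f` at the point `q`. -/
def ev (f q : Pt) : ℝ := f.1 * q.1 + f.2 * q.2

/-- Orientation determinant of three points. -/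
def det3 (a b c : Pt) : ℝ := (b.1 - a.1) * (c.2 - a.2) - (b.2 - a.2) * (c.1 - a.1)

lemma ev_comm' (f q : Pt) : ev f q = ev q f := by
  unfold ev; ring

lemma ev_comb (f x y : Pt) (a b : ℝ) : ev f (a • x + b • y) = a * ev f x + b * ev f y := by
  simp [ev]; ring

lemma sq_pos_of_ne {p q : Pt} (h : p ≠ q) : 0 < (q.1 - p.1) ^ 2 + (q.2 - p.2) ^ 2 := by
  by_contra hc
  push Not at hc
  apply h
  have h1 : q.1 - p.1 = 0 := by nlinarith [sq_nonneg (q.1 - p.1), sq_nonneg (q.2 - p.2)]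
  have h2 : q.2 - p.2 = 0 := by nlinarith [sq_nonneg (q.1 - p.1), sq_nonneg (q.2 - p.2)]
  ext <;> linarith

lemma side_lemma {f p q : Pt} (hp : ev f p = 1) (hq : ev f q = 1) (hne : p ≠ q) :
    ∃ κ : ℝ, κ ≠ 0 ∧ ∀ r, ev f r - 1 = κ * det3 p q r := by
  have hd := sq_pos_of_ne hne
  set D := (q.1 - p.1) ^ 2 + (q.2 - p.2) ^ 2 with hD
  have key : ∀ r, ev f r - 1 = (f.2 * (q.1 - p.1) - f.1 * (q.2 - p.2)) / D * det3 p q r := by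
    intro r
    rw [div_mul_eq_mul_div, eq_div_iff hd.ne']
    have h0 : f.1 * (q.1 - p.1) + f.2 * (q.2 - p.2) = 0 := by
      unfold ev at hp hq; linarith
    have h1 : ev f r - 1 = f.1 * (r.1 - p.1) + f.2 * (r.2 - p.2) := by
      unfold ev at *; linarith
    rw [h1, hD]
    unfold det3
    linear_combination ((q.1 - p.1) * (r.1 - p.1) + (q.2 - p.2) * (r.2 - p.2)) * h0
  refine ⟨_, ?_, key⟩
  intro h
  have := key 0
  rw [h] at this
  simp [ev] at this

lemma collin {f p q r : Pt} (hp : ev f p = 1) (hq : ev f q = 1) (hr : ev f r = 1) (hne : p ≠ q) :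
    ∃ t : ℝ, r = (1 - t) • p + t • q := by
  obtain ⟨κ, hκ, h⟩ := side_lemma hp hq hne
  have h0 : det3 p q r = 0 := by
    have := h r
    rw [hr] at this
    have : κ * det3 p q r = 0 := by linarith
    simpa [hκ] using this
  have hd := sq_pos_of_ne hne
  refine ⟨((q.1 - p.1) * (r.1 - p.1) + (q.2 - p.2) * (r.2 - p.2)) /
    ((q.1 - p.1) ^ 2 + (q.2 - p.2) ^ 2), ?_⟩
  unfold det3 at h0
  ext
  · simp
    field_simp
    linear_combination (-(q.2 - p.2)) * h0
  · simp
    field_simp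
    linear_combination ((q.1 - p.1)) * h0

lemma tri {f p q r : Pt} (hp : ev f p = 1) (hq : ev f q = 1) (hr : ev f r = 1) (hpq : p ≠ q)
    (hqr : q ≠ r) (hrp : r ≠ p) :
    r ∈ openSegment ℝ p q ∨ p ∈ openSegment ℝ q r ∨ q ∈ openSegment ℝ r p := by
  obtain ⟨t, rfl⟩ := collin hp hq hr hpq
  have t0 : t ≠ 0 := by rintro rfl; simp at hrp
  have t1 : t ≠ 1 := by rintro rfl; simp at hqr
  rcases lt_or_gt_of_ne t0 with h | h
  · right; left
    have h1 : 0 < 1 - t := by linarith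
    refine ⟨-t / (1 - t), 1 / (1 - t), by apply div_pos <;> linarith, by positivity, by field_simp; ring, ?_⟩
    ext <;> simp <;> field_simp <;> ring
  · rcases lt_or_gt_of_ne t1 with h' | h'
    · left
      exact ⟨1 - t, t, by linarith, h, by ring, rfl⟩
    · right; right
      refine ⟨1 / t, (t - 1) / t, by positivity, by apply div_pos <;> linarith, by field_simp; ring, ?_⟩
      ext <;> simp <;> field_simp <;> ring

lemma three_pts {P : Set Pt} {f p q r : Pt} (hp : ev f p = 1) (hq : ev f q = 1) (hr : ev f r = 1)
    (hpq : p ≠ q) (hpE : p ∈ extremePoints ℝ P) (hqE : q ∈ extremePoints ℝ P)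
    (hrE : r ∈ extremePoints ℝ P) : r = p ∨ r = q := by
  by_contra hc
  push Not at hc
  rcases tri hp hq hr hpq hc.2.symm hc.1 with h | h | h
  · exact hc.1 (hrE.2 hpE.1 hqE.1 h).symm
  · exact hpq (hpE.2 hqE.1 hrE.1 h).symm
  · exact hc.2 (hqE.2 hrE.1 hpE.1 h)

/-- two functionals equal to one at two different points coincide -/
lemma ev_unique {f g p q : Pt} (h1 : ev f p = 1) (h2 : ev f q = 1) (h3 : ev g p = 1)
    (h4 : ev g q = 1) (hpq : p ≠ q) : f = g := by
  by_contra hfg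
  obtain ⟨κ, hκ, h⟩ := side_lemma h1 h2 hpq
  obtain ⟨κ', hκ', h'⟩ := side_lemma h3 h4 hpq
  have e1 := h 0
  have e2 := h' 0
  have hd : det3 p q 0 ≠ 0 := by
    intro hd; rw [hd] at e1; simp [ev] at e1
  have e3 : κ = κ' := by
    have : (κ - κ') * det3 p q 0 = 0 := by
      simp only [ev, Prod.fst_zero, Prod.snd_zero] at e1 e2
      linarith
    simp [hd] at this
    linarith
  apply hfg
  have a1 := h (1, 0)
  have a2 := h (0, 1)
  have b1 := h' (1, 0)
  have b2 := h' (0, 1)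
  subst e3
  simp [ev] at a1 a2 b1 b2
  ext <;> linarith

lemma endpoint_extreme {P : Set Pt} {a b : Pt} (h : IsEdgeOf P a b) : a ∈ extremePoints ℝ P := by
  apply h.2.extremePoints_subset_extremePoints
  refine ⟨left_mem_segment ℝ a b, ?_⟩
  intro x hx y hy hz
  rw [segment_eq_image'] at hx hy
  obtain ⟨s, hs, rfl⟩ := hx
  obtain ⟨t, ht, rfl⟩ := hy
  obtain ⟨c, d, hc, hd, hcd, he⟩ := hz
  have hsq := sq_pos_of_ne h.1
  have e1 := congrArg Prod.fst he
  have e2 := congrArg Prod.snd he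
  simp at e1 e2
  have k1 : (c * s + d * t) * (b.1 - a.1) = 0 := by linear_combination e1 - a.1 * hcd
  have k2 : (c * s + d * t) * (b.2 - a.2) = 0 := by linear_combination e2 - a.2 * hcd
  have k : c * s + d * t = 0 := by
    have : (c * s + d * t) * ((b.1 - a.1) ^ 2 + (b.2 - a.2) ^ 2) = 0 := by
      linear_combination (b.1 - a.1) * k1 + (b.2 - a.2) * k2
    simpa [hsq.ne'] using this
  have s0 : s = 0 := by
    have := mul_nonneg hc.le hs.1
    have := mul_nonneg hd.le ht.1
    have : c * s = 0 := by linarith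
    simpa [hc.ne'] using this
  simp [s0]

lemma edge_symm {P : Set Pt} {a b : Pt} (h : IsEdgeOf P a b) : IsEdgeOf P b a :=
  ⟨h.1.symm, by rw [segment_symm]; exact h.2⟩

lemma support {P : Set Pt} (hP : Convex ℝ P) (h0 : (0 : Pt) ∈ interior P) {a b : Pt}
    (h : IsEdgeOf P a b) :
    ∃ f : Pt, (∀ q ∈ P, ev f q ≤ 1) ∧ ev f a = 1 ∧ ev f b = 1 := by
  have hu : midpoint ℝ a b ∉ interior P := by
    intro hu
    set w : Pt := (-(b.2 - a.2), b.1 - a.1) with hw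
    have c1 : Continuous (fun t : ℝ => midpoint ℝ a b + t • w) := by fun_prop
    have c2 : Continuous (fun t : ℝ => midpoint ℝ a b - t • w) := by fun_prop
    have n1 : ∀ᶠ t in nhds (0 : ℝ), midpoint ℝ a b + t • w ∈ P := by
      apply c1.continuousAt.eventually_mem
      simpa using mem_interior_iff_mem_nhds.1 hu
    have n2 : ∀ᶠ t in nhds (0 : ℝ), midpoint ℝ a b - t • w ∈ P := by
      apply c2.continuousAt.eventually_mem
      simpa using mem_interior_iff_mem_nhds.1 hu
    obtain ⟨ε, hε, hb⟩ := Metric.eventually_nhds_iff.1 (n1.and n2)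
    have hb' := @hb (ε / 2) (by simp [abs_of_pos hε]; linarith)
    have hm := h.2.left_mem_of_mem_openSegment hb'.1 hb'.2 (midpoint_mem_segment a b)
      ⟨1 / 2, 1 / 2, by norm_num, by norm_num, by norm_num, by ext <;> simp <;> ring⟩
    rw [segment_eq_image'] at hm
    obtain ⟨s, hs, he⟩ := hm
    have hsq := sq_pos_of_ne h.1
    have e1 := congrArg Prod.fst he
    have e2 := congrArg Prod.snd he
    simp [hw, midpoint_eq_smul_add] at e1 e2
    have : ε / 2 * ((b.1 - a.1) ^ 2 + (b.2 - a.2) ^ 2) = 0 := by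
      linear_combination (b.2 - a.2) * e1 - (b.1 - a.1) * e2
    have : 0 < ε / 2 * ((b.1 - a.1) ^ 2 + (b.2 - a.2) ^ 2) := by positivity
    linarith
  obtain ⟨g, hg⟩ := geometric_hahn_banach_open_point hP.interior isOpen_interior hu
  have gc : 0 < g (midpoint ℝ a b) := by simpa using hg 0 h0
  have hle : ∀ q ∈ P, g q ≤ g (midpoint ℝ a b) := by
    intro q hq
    have hq' : q ∈ closure (interior P) := by
      rw [hP.closure_interior_eq_closure_of_nonempty_interior ⟨0, h0⟩]
      exact subset_closure hq
    have : closure (interior P) ⊆ {q | g q ≤ g (midpoint ℝ a b)} :=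
      closure_minimal (fun x hx => (hg x hx).le) (isClosed_le (by fun_prop) (by fun_prop))
    exact this hq'
  set c := g (midpoint ℝ a b) with hc
  have hev : ∀ q, ev (g (1, 0) / c, g (0, 1) / c) q = g q / c := by
    intro q
    have : q = q.1 • ((1, 0) : Pt) + q.2 • ((0, 1) : Pt) := by ext <;> simp
    have h2 : g q = q.1 * g (1, 0) + q.2 * g (0, 1) := by
      conv_lhs => rw [this]
      rw [map_add, map_smul, map_smul]; simp
    rw [h2]; simp only [ev]; ring
  have ha := h.2.subset (left_mem_segment ℝ a b)
  have hb := h.2.subset (right_mem_segment ℝ a b)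
  have hmid : c = (g a + g b) / 2 := by
    rw [hc, midpoint_eq_smul_add, map_smul, map_add]; simp; ring
  refine ⟨(g (1, 0) / c, g (0, 1) / c), ?_, ?_, ?_⟩
  · intro q hq
    rw [hev, div_le_one gc]; exact hle q hq
  · rw [hev, div_eq_one_iff_eq gc.ne']
    linarith [hle a ha, hle b hb]
  · rw [hev, div_eq_one_iff_eq gc.ne']
    linarith [hle a ha, hle b hb]

/-- the open region cut out by the four sides of `Q*` -/
def InQ (v : Pt) : Prop :=
  v.1 + 2 * v.2 < 5 / 2 ∧ -v.1 + 2 * v.2 < 5 / 2 ∧ 1 + v.1 < v.2 ∧ 1 - v.1 < v.2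

lemma comb3 {C : Set Pt} (hC : Convex ℝ C) {p q r : Pt} (hp : p ∈ C) (hq : q ∈ C) (hr : r ∈ C)
    {a b c : ℝ} (ha : 0 ≤ a) (hb : 0 ≤ b) (hc : 0 ≤ c) (h : a + b + c = 1) :
    a • p + b • q + c • r ∈ C := by
  have := hC.sum_mem (t := Finset.univ) (w := ![a, b, c]) (z := ![p, q, r])
    (by intro i _; fin_cases i <;> simpa) (by simp [Fin.sum_univ_three, h])
    (by intro i _; fin_cases i <;> simpa)
  simpa [Fin.sum_univ_three] using this

lemma inQ_interior {v : Pt} (h : InQ v) : v ∈ interior Qstar := by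
  have hop : IsOpen {v : Pt | InQ v} := by
    unfold InQ
    refine IsOpen.and ?_ (IsOpen.and ?_ (IsOpen.and ?_ ?_)) <;>
      exact isOpen_lt (by fun_prop) (by fun_prop)
  refine interior_maximal ?_ hop h
  rintro ⟨x, y⟩ ⟨h1, h2, h3, h4⟩
  simp only at h1 h2 h3 h4
  have hC : Convex ℝ Qstar := convex_convexHull _ _
  have m1 : ((0, 5/4) : Pt) ∈ Qstar := subset_convexHull _ _ (by simp)
  have m2 : ((1/6, 7/6) : Pt) ∈ Qstar := subset_convexHull _ _ (by simp)
  have m3 : ((0, 1) : Pt) ∈ Qstar := subset_convexHull _ _ (by simp)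
  have m4 : ((-1/6, 7/6) : Pt) ∈ Qstar := subset_convexHull _ _ (by simp)
  rcases le_total (7/6) y with hy | hy
  · have := comb3 hC m1 m2 m4 (a := 12 * y - 14) (b := (15 - 12 * y + 6 * x) / 2)
      (c := (15 - 12 * y - 6 * x) / 2) (by linarith) (by linarith) (by linarith) (by ring)
    convert this using 1
    ext <;> simp <;> ring
  · have := comb3 hC m3 m2 m4 (a := 7 - 6 * y) (b := (6 * y - 6 + 6 * x) / 2)
      (c := (6 * y - 6 - 6 * x) / 2) (by linarith) (by linarith) (by linarith) (by ring)
    convert this using 1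
    ext <;> simp <;> ring

lemma interior_half {S : Set Pt} {f : Pt} {c : ℝ} (hf : f ≠ 0) (hS : ∀ q ∈ S, ev f q ≤ c) :
    ∀ q ∈ interior S, ev f q < c := by
  intro q hq
  have c1 : Continuous (fun t : ℝ => q + t • f) := by fun_prop
  have n1 : ∀ᶠ t in nhds (0 : ℝ), q + t • f ∈ S := by
    apply c1.continuousAt.eventually_mem
    simpa using mem_interior_iff_mem_nhds.1 hq
  obtain ⟨ε, hε, hb⟩ := Metric.eventually_nhds_iff.1 n1
  have hb' := hS _ (@hb (ε / 2) (by simp [abs_of_pos hε]; linarith))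
  have e : ev f (q + (ε / 2) • f) = ev f q + ε / 2 * (f.1 ^ 2 + f.2 ^ 2) := by
    simp [ev]; ring
  have hsq := sq_pos_of_ne hf.symm
  simp at hsq
  have : 0 < ε / 2 * (f.1 ^ 2 + f.2 ^ 2) := by positivity
  linarith

lemma interior_inQ {v : Pt} (h : v ∈ interior Qstar) : InQ v := by
  have key : ∀ (f : Pt) (c : ℝ), f ≠ 0 →
      (∀ q ∈ ({(0, 5/4), (1/6, 7/6), (0, 1), (-1/6, 7/6)} : Set Pt), ev f q ≤ c) → ev f v < c := by
    intro f c hf hq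
    refine interior_half hf ?_ v h
    intro q hqQ
    have : Qstar ⊆ {q | ev f q ≤ c} := by
      refine convexHull_min hq ?_
      intro x hx y hy a b ha hb hab
      simp only [mem_ofPred_eq] at *
      rw [ev_comb]
      calc _ ≤ a * c + b * c := by gcongr
        _ = c := by rw [← add_mul, hab, one_mul]
    exact this hqQ
  have k1 := key (1, 2) (5/2) (by simp) (by simp [ev]; norm_num)
  have k2 := key (-1, 2) (5/2) (by simp) (by simp [ev]; norm_num)
  have k3 := key (1, -1) (-1) (by simp) (by simp [ev]; norm_num)
  have k4 := key (-1, -1) (-1) (by simp) (by simp [ev]; norm_num)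
  simp only [ev] at k1 k2 k3 k4
  refine ⟨?_, ?_, ?_, ?_⟩ <;> linarith

lemma det3_comb (a b x y : Pt) {c d : ℝ} (h : c + d = 1) :
    det3 a b (c • x + d • y) = c * det3 a b x + d * det3 a b y := by
  have : d = 1 - c := by linarith
  subst this
  simp [det3]; ring

lemma face_lemma {W : Fin 10 → Pt}
    (hW : ∀ i k, k ≠ i → k ≠ i + 1 → 0 < det3 (W i) (W (i + 1)) (W k)) (i : Fin 10) :
    ∀ q ∈ convexHull ℝ (range W), 0 < det3 (W i) (W (i + 1)) q ∨ q ∈ segment ℝ (W i) (W (i + 1)) := by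
  have : convexHull ℝ (range W) ⊆
      {q | 0 < det3 (W i) (W (i + 1)) q ∨ q ∈ segment ℝ (W i) (W (i + 1))} := by
    have hseg : ∀ q ∈ segment ℝ (W i) (W (i + 1)), det3 (W i) (W (i + 1)) q = 0 := by
      rintro q ⟨a, b, ha, hb, hab, rfl⟩
      rw [det3_comb _ _ _ _ hab]; simp [det3]; right; ring
    refine convexHull_min ?_ ?_
    · rintro _ ⟨k, rfl⟩
      by_cases h1 : k = i
      · right; rw [h1]; exact left_mem_segment ℝ _ _
      by_cases h2 : k = i + 1
      · right; rw [h2]; exact right_mem_segment ℝ _ _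
      exact Or.inl (hW i k h1 h2)
    · rw [convex_iff_forall_pos]
      intro x hx y hy a b ha hb hab
      simp only [mem_ofPred_eq] at *
      rw [det3_comb _ _ _ _ hab]
      rcases hx with hx | hx <;> rcases hy with hy | hy
      · left; positivity
      · left; rw [hseg y hy]; simp; positivity
      · left; rw [hseg x hx]; simp; positivity
      · right; exact convex_segment _ _ hx hy ha.le hb.le hab
  exact fun q hq => this hq

lemma fin_ne1 : ∀ i : Fin 10, i + 2 ≠ i := by decide

lemma fin_ne2 : ∀ i : Fin 10, i + 2 ≠ i + 1 := by decide

lemma edge_W {W : Fin 10 → Pt}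
    (hW : ∀ i k, k ≠ i → k ≠ i + 1 → 0 < det3 (W i) (W (i + 1)) (W k)) (i : Fin 10) :
    IsEdgeOf (convexHull ℝ (range W)) (W i) (W (i + 1)) := by
  have hseg : ∀ q ∈ segment ℝ (W i) (W (i + 1)), det3 (W i) (W (i + 1)) q = 0 := by
    rintro q ⟨a, b, ha, hb, hab, rfl⟩
    rw [det3_comb _ _ _ _ hab]; simp [det3]; right; ring
  have hnn : ∀ q ∈ convexHull ℝ (range W), 0 ≤ det3 (W i) (W (i + 1)) q := by
    intro q hq
    rcases face_lemma hW i q hq with h | h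
    · exact h.le
    · exact (hseg q h).ge
  refine ⟨?_, ?_, ?_⟩
  · intro he
    have := hW i (i + 2) (fin_ne1 i) (fin_ne2 i)
    rw [← he] at this
    simp [det3] at this
  · exact (convex_convexHull ℝ _).segment_subset (subset_convexHull _ _ ⟨i, rfl⟩)
      (subset_convexHull _ _ ⟨i + 1, rfl⟩)
  · rintro x hx y hy z hz ⟨a, b, ha, hb, hab, rfl⟩
    have h1 := hseg _ hz
    rw [det3_comb _ _ _ _ hab] at h1
    rcases face_lemma hW i x hx with h | h
    · have := mul_pos ha h
      have := mul_nonneg hb.le (hnn y hy)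
      linarith
    · exact h

lemma inj_W {W : Fin 10 → Pt}
    (hW : ∀ i k, k ≠ i → k ≠ i + 1 → 0 < det3 (W i) (W (i + 1)) (W k)) :
    Function.Injective W := by
  intro i j hij
  by_contra hne
  by_cases h : j = i + 1
  · subst h; exact (edge_W hW i).1 hij
  · have := hW i j (Ne.symm hne) h
    rw [← hij] at this
    simp [det3] at this

lemma polygon_W {W : Fin 10 → Pt}
    (hW : ∀ i k, k ≠ i → k ≠ i + 1 → 0 < det3 (W i) (W (i + 1)) (W k))
    (h0 : (0 : Pt) ∈ interior (convexHull ℝ (range W))) :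
    IsConvexPolygon (convexHull ℝ (range W)) 10 ∧
    extremePoints ℝ (convexHull ℝ (range W)) = range W ∧
    edgeMidpoints (convexHull ℝ (range W)) = range fun i => midpoint ℝ (W i) (W (i + 1)) := by
  have hE : extremePoints ℝ (convexHull ℝ (range W)) = range W := by
    apply Subset.antisymm extremePoints_convexHull_subset
    rintro _ ⟨i, rfl⟩
    exact endpoint_extreme (edge_W hW i)
  refine ⟨⟨convex_convexHull _ _, (finite_range W).isCompact_convexHull (𝕜 := ℝ), ⟨0, h0⟩, ?_, ?_, ?_⟩, hE, ?_⟩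
  · rw [hE]; exact finite_range W
  · rw [hE, ← image_univ, ncard_image_of_injective _ (inj_W hW)]; simp
  · rw [hE]
  · apply Subset.antisymm
    · rintro u ⟨a, b, hab, rfl⟩
      obtain ⟨i, rfl⟩ : a ∈ range W := hE ▸ endpoint_extreme hab
      obtain ⟨j, rfl⟩ : b ∈ range W := hE ▸ endpoint_extreme (edge_symm hab)
      by_cases h1 : j = i + 1
      · exact ⟨i, by rw [h1]⟩
      by_cases h2 : i = j + 1
      · exact ⟨j, by rw [h2, midpoint_comm]⟩
      exfalso
      have hij : j ≠ i := by rintro rfl; exact hab.1 rfl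
      obtain ⟨f, hf, fa, fb⟩ := support (convex_convexHull _ _) h0 hab
      obtain ⟨κ, hκ, h⟩ := side_lemma fa fb hab.1
      have s1 := hW i j hij h1
      obtain ⟨m, hm⟩ : ∃ m : Fin 10, i = m + 1 := ⟨i - 1, by simp⟩
      have s2 := hW m j (by rintro rfl; exact h2 hm) (by rw [← hm]; exact hij)
      rw [← hm] at s2
      have t1 := hf (W (i + 1)) (subset_convexHull _ _ ⟨_, rfl⟩)
      have t2 := hf (W m) (subset_convexHull _ _ ⟨_, rfl⟩)
      have q1 := h (W (i + 1))
      have q2 := h (W m)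
      have g1 : det3 (W i) (W j) (W (i + 1)) = - det3 (W i) (W (i + 1)) (W j) := by
        unfold det3; ring
      have g2 : det3 (W i) (W j) (W m) = det3 (W m) (W i) (W j) := by
        unfold det3; ring
      rw [g1] at q1
      rw [g2] at q2
      rcases lt_or_gt_of_ne hκ with hk | hk
      · have := mul_pos_of_neg_of_neg hk (neg_lt_zero.2 s1)
        linarith
      · have := mul_pos hk s2
        linarith
    · rintro _ ⟨i, rfl⟩
      exact ⟨_, _, edge_W hW i, rfl⟩

/-- The ten vertices of the decagon through `(x, y)`. -/
def Wv (x y : ℝ) : Fin 10 → Pt :=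
  ![(x, y), (-1 - x, 2 - y), (x - 2, y - 1), (-2 - x, 1 - y), (x - 1, y - 2),
    (-x, -y), (1 + x, y - 2), (2 - x, 1 - y), (2 + x, y - 1), (1 - x, 2 - y)]

lemma Wv_pos {x y : ℝ} (h : InQ (x, y)) :
    ∀ i k, k ≠ i → k ≠ i + 1 → 0 < det3 (Wv x y i) (Wv x y (i + 1)) (Wv x y k) := by
  obtain ⟨h1, h2, h3, h4⟩ := h
  simp only at h1 h2 h3 h4
  intro i k
  fin_cases i <;> fin_cases k <;> simp [Wv, det3] <;> linarith

lemma Wv_mid (x y : ℝ) : (range fun i => midpoint ℝ (Wv x y i) (Wv x y (i + 1))) = D2 := by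
  have key : (fun i => midpoint ℝ (Wv x y i) (Wv x y (i + 1))) =
      ![(-1/2, 1), (-3/2, 1/2), (-2, 0), (-3/2, -1/2), (-1/2, -1), (1/2, -1), (3/2, -1/2), (2, 0),
        (3/2, 1/2), (1/2, 1)] := by
    funext i
    fin_cases i <;> simp [Wv, midpoint_eq_smul_add] <;> (try constructor) <;> ring
  rw [key]
  simp only [Matrix.range_cons, Matrix.range_empty, D2]
  ext p
  simp only [mem_union, mem_singleton_iff, mem_insert_iff, mem_empty_iff_false]
  tauto

lemma part_b : ∀ v ∈ interior Qstar, ∃ P : Set Pt, IsConvexPolygon P 10 ∧ P = -P ∧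
      edgeMidpoints P = D2 ∧ v ∈ Set.extremePoints ℝ P := by
  rintro ⟨x, y⟩ hv
  have hQ := interior_inQ hv
  have hW := Wv_pos hQ
  have hC : Convex ℝ (convexHull ℝ (range (Wv x y))) := convex_convexHull _ _
  have hsym : convexHull ℝ (range (Wv x y)) = -convexHull ℝ (range (Wv x y)) := by
    rw [← convexHull_neg]
    congr 1
    ext p
    simp only [Wv, Matrix.range_cons, Matrix.range_empty, mem_neg, mem_union, mem_singleton_iff,
      mem_empty_iff_false, neg_eq_iff_eq_neg, Prod.neg_mk, neg_sub, neg_neg, neg_add_rev]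
    have e3 : -x + -1 = -1 - x := by ring
    have e4 : -x + -2 = -2 - x := by ring
    have e1 : x - -1 = 1 + x := by ring
    have e2 : x - -2 = 2 + x := by ring
    rw [e1, e2, e3, e4]
    tauto
  have hmem : ∀ u ∈ D2, u ∈ convexHull ℝ (range (Wv x y)) := by
    intro u hu
    rw [← Wv_mid x y] at hu
    obtain ⟨i, rfl⟩ := hu
    exact hC.midpoint_mem (subset_convexHull _ _ ⟨_, rfl⟩) (subset_convexHull _ _ ⟨_, rfl⟩)
  have h0 : (0 : Pt) ∈ interior (convexHull ℝ (range (Wv x y))) := by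
    rw [mem_interior_iff_mem_nhds, Metric.mem_nhds_iff]
    refine ⟨1 / 2, by norm_num, ?_⟩
    rintro ⟨p, q⟩ hpq
    simp at hpq
    obtain ⟨hp, hq⟩ := hpq
    rw [abs_lt] at hp hq
    have m1 : ((2, 0) : Pt) ∈ convexHull ℝ (range (Wv x y)) := hmem _ (by simp [D2])
    have m2 : ((-2, 0) : Pt) ∈ convexHull ℝ (range (Wv x y)) := hmem _ (by simp [D2])
    have m3 : ((0, 1) : Pt) ∈ convexHull ℝ (range (Wv x y)) := by
      have := hC.midpoint_mem (hmem (1/2, 1) (by simp [D2])) (hmem (-1/2, 1) (by simp [D2]))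
      convert this using 1
      ext <;> simp [midpoint_eq_smul_add] <;> norm_num
    have m4 : ((0, -1) : Pt) ∈ convexHull ℝ (range (Wv x y)) := by
      have := hC.midpoint_mem (hmem (1/2, -1) (by simp [D2])) (hmem (-1/2, -1) (by simp [D2]))
      convert this using 1
      ext <;> simp [midpoint_eq_smul_add] <;> norm_num
    have s1 : ((2 * p, 0) : Pt) ∈ convexHull ℝ (range (Wv x y)) := by
      have := hC m1 m2 (a := (1 + p) / 2) (b := (1 - p) / 2) (by linarith) (by linarith) (by ring)
      convert this using 1
      ext <;> simp; ring
    have s2 : ((0, 2 * q) : Pt) ∈ convexHull ℝ (range (Wv x y)) := by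
      have := hC m3 m4 (a := (1 + 2 * q) / 2) (b := (1 - 2 * q) / 2) (by linarith) (by linarith)
        (by ring)
      convert this using 1
      ext <;> simp; ring
    have := hC.midpoint_mem s1 s2
    convert this using 1
    ext <;> simp [midpoint_eq_smul_add]
  obtain ⟨r1, r2, r3⟩ := polygon_W hW h0
  refine ⟨_, r1, hsym, r3.trans (Wv_mid x y), ?_⟩
  rw [r2]
  exact ⟨0, rfl⟩

/-- The ten midpoints in cyclic order. -/
def Uv : Fin 10 → Pt :=
  ![(-1/2, 1), (-3/2, 1/2), (-2, 0), (-3/2, -1/2), (-1/2, -1), (1/2, -1), (3/2, -1/2), (2, 0),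
    (3/2, 1/2), (1/2, 1)]

/-- Edge data of a decagon: edges `[a i, b i]` with midpoints `U i` and supporting
functionals `f i`. -/
structure EdgeData (P : Set Pt) (U f a b : Fin 10 → Pt) : Prop where
  fin : (extremePoints ℝ P).Finite
  card : (extremePoints ℝ P).ncard = 10
  ha : ∀ i, a i ∈ extremePoints ℝ P
  hb : ∀ i, b i ∈ extremePoints ℝ P
  hab : ∀ i, a i ≠ b i
  fa : ∀ i, ev (f i) (a i) = 1
  fb : ∀ i, ev (f i) (b i) = 1
  hf : ∀ i, ∀ q ∈ P, ev (f i) q ≤ 1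
  mid : ∀ i, U i = midpoint ℝ (a i) (b i)
  inj : Function.Injective U

namespace EdgeData

variable {P : Set Pt} {U f a b : Fin 10 → Pt}

lemma evU (D : EdgeData P U f a b) (g : Pt) (i : Fin 10) :
    ev g (U i) = (ev g (a i) + ev g (b i)) / 2 := by
  rw [D.mid i, midpoint_eq_smul_add]; simp [ev]; ring

lemma mid_of (D : EdgeData P U f a b) {i : Fin 10} {p q : Pt} (hp : p ∈ extremePoints ℝ P)
    (hq : q ∈ extremePoints ℝ P) (hpq : p ≠ q) (h1 : ev (f i) p = 1) (h2 : ev (f i) q = 1) :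
    U i = midpoint ℝ p q := by
  rw [D.mid i]
  rcases three_pts (D.fa i) (D.fb i) h1 (D.hab i) (D.ha i) (D.hb i) hp with rfl | rfl <;>
  rcases three_pts (D.fa i) (D.fb i) h2 (D.hab i) (D.ha i) (D.hb i) hq with rfl | rfl
  · exact absurd rfl hpq
  · rfl
  · exact midpoint_comm _ _
  · exact absurd rfl hpq

lemma finj (D : EdgeData P U f a b) {i j : Fin 10} (h : f i = f j) : i = j := by
  apply D.inj
  rw [D.mid j]
  exact D.mid_of (D.ha j) (D.hb j) (D.hab j) (h ▸ D.fa j) (h ▸ D.fb j)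

lemma ltU (D : EdgeData P U f a b) {i j : Fin 10} (h : i ≠ j) : ev (f j) (U i) < 1 := by
  rw [D.evU]
  have h1 := D.hf j _ (D.ha i).1
  have h2 := D.hf j _ (D.hb i).1
  by_contra hc
  push Not at hc
  exact h (D.finj (ev_unique (D.fa i) (D.fb i) (by linarith) (by linarith) (D.hab i)))

lemma UU (D : EdgeData P U f a b) (i : Fin 10) : ev (f i) (U i) = 1 := by
  rw [D.evU, D.fa, D.fb]; norm_num

lemma no_between (D : EdgeData P U f a b) {i j k : Fin 10} (hik : i ≠ k) (hjk : j ≠ k)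
    (h : f k ∈ openSegment ℝ (f i) (f j)) : False := by
  obtain ⟨c, d, hc, hd, hcd, he⟩ := h
  have e := D.UU k
  rw [← he, ev_comm', ev_comb, ev_comm' _ (f i), ev_comm' _ (f j)] at e
  have h1 := mul_lt_mul_of_pos_left (D.ltU hik.symm) hc
  have h2 := mul_lt_mul_of_pos_left (D.ltU hjk.symm) hd
  linarith

lemma two (D : EdgeData P U f a b) {i j k : Fin 10} {p : Pt} (hij : i ≠ j)
    (hi : ev (f i) p = 1) (hj : ev (f j) p = 1) (hk : ev (f k) p = 1) : k = i ∨ k = j := by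
  by_contra hc
  push Not at hc
  rw [ev_comm'] at hi hj hk
  rcases tri hi hj hk (fun h => hij (D.finj h)) (fun h => hc.2 (D.finj h).symm)
    (fun h => hc.1 (D.finj h)) with h | h | h
  · exact D.no_between hc.1.symm hc.2.symm h
  · exact D.no_between hij.symm hc.1 h
  · exact D.no_between hc.2 hij h

open Classical in
lemma other (D : EdgeData P U f a b) {i : Fin 10} {p : Pt} (hp : p ∈ extremePoints ℝ P)
    (hi : ev (f i) p = 1) : ∃ j, j ≠ i ∧ ev (f j) p = 1 := by
  by_contra hc
  push Not at hc
  set T := D.fin.toFinset with hT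
  have hTc : T.card = 10 := by rw [hT, ← ncard_eq_toFinset_card _ D.fin]; exact D.card
  have hpT : p ∈ T := by simpa [hT] using hp
  have hdc := Finset.sum_card_bipartiteAbove_eq_sum_card_bipartiteBelow
    (s := (Finset.univ : Finset (Fin 10))) (t := T) (fun i q => ev (f i) q = 1)
  have hlow : 20 ≤ ∑ i : Fin 10, (T.bipartiteAbove (fun i q => ev (f i) q = 1) i).card := by
    calc 20 = ∑ i : Fin 10, 2 := by simp
      _ ≤ _ := by
        apply Finset.sum_le_sum
        intro k _
        rw [← Finset.card_pair (D.hab k)]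
        apply Finset.card_le_card
        intro q hq
        simp only [Finset.mem_insert, Finset.mem_singleton] at hq
        simp only [Finset.bipartiteAbove, Finset.mem_filter, hT, Finite.mem_toFinset]
        rcases hq with rfl | rfl
        · exact ⟨D.ha k, D.fa k⟩
        · exact ⟨D.hb k, D.fb k⟩
  have hup : ∑ q ∈ T, ((Finset.univ : Finset (Fin 10)).bipartiteBelow
      (fun i q => ev (f i) q = 1) q).card < ∑ q ∈ T, 2 := by
    apply Finset.sum_lt_sum
    · intro q _
      by_contra h
      push Not at h
      obtain ⟨x, y, z, hx, hy, hz, hxy, hxz, hyz⟩ := Finset.two_lt_card_iff.1 h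
      simp [Finset.bipartiteBelow] at hx hy hz
      rcases D.two hxy hx hy hz with h | h
      · exact hxz h.symm
      · exact hyz h.symm
    · refine ⟨p, hpT, ?_⟩
      have : (Finset.univ : Finset (Fin 10)).bipartiteBelow (fun i q => ev (f i) q = 1) p ⊆ {i} := by
        intro j hj
        simp [Finset.bipartiteBelow] at hj
        by_contra hji
        exact hc j (by simpa using hji) hj
      have := Finset.card_le_card this
      simp only [Finset.card_singleton] at this
      omega
  rw [← hdc] at hup
  simp only [Finset.sum_const, hTc] at hup
  simp at hup
  omega

lemma sign (D : EdgeData P U f a b) {i j k : Fin 10} {p : Pt} (hij : i ≠ j) (hki : k ≠ i)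
    (hkj : k ≠ j) (hp : p ∈ P)
    (hi : ev (f i) p = 1) (hj : ev (f j) p = 1) :
    det3 (U i) (U j) (U k) * det3 (U i) (U j) p < 0 := by
  have hfij : f i ≠ f j := fun h => hij (D.finj h)
  have ti : 0 < 1 - ev (f j) (U i) := by linarith [D.ltU hij]
  have sj : 0 < 1 - ev (f i) (U j) := by linarith [D.ltU hij.symm]
  have sk : 0 < 1 - ev (f i) (U k) := by linarith [D.ltU hki]
  have tk : 0 < 1 - ev (f j) (U k) := by linarith [D.ltU hkj]
  obtain ⟨l, hl⟩ : ∃ l, l = (1 - ev (f i) (U k)) / (1 - ev (f i) (U j)) := ⟨_, rfl⟩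
  obtain ⟨m, hm⟩ : ∃ m, m = (1 - ev (f j) (U k)) / (1 - ev (f j) (U i)) := ⟨_, rfl⟩
  have hl0 : 0 < l := by rw [hl]; positivity
  have hm0 : 0 < m := by rw [hm]; positivity
  rw [eq_div_iff sj.ne'] at hl
  rw [eq_div_iff ti.ne'] at hm
  have hpi : p ≠ U i := by
    rintro rfl; linarith
  -- the point with coordinates `(l, m)` is `U k`
  obtain ⟨q, hq⟩ : ∃ q : Pt, q = (1 - l - m) • p + l • U j + m • U i := ⟨_, rfl⟩
  have hev : ∀ g : Pt, ev g q = (1 - l - m) * ev g p + l * ev g (U j) + m * ev g (U i) := by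
    intro g; rw [hq]; simp [ev]; ring
  have qi : ev (f i) q = ev (f i) (U k) := by
    rw [hev, hi, D.UU]; linarith
  have qj : ev (f j) q = ev (f j) (U k) := by
    rw [hev, hj, D.UU]; linarith
  have hdet : (f i).1 * (f j).2 - (f i).2 * (f j).1 ≠ 0 := by
    intro h0
    obtain ⟨κ, hκ, h⟩ := side_lemma (f := p) (by rw [ev_comm']; exact hi)
      (by rw [ev_comm']; exact hj) hfij
    have := h 0
    simp [ev, det3] at this
    have h1 : κ * ((f i).1 * (f j).2 - (f i).2 * (f j).1) = -1 := by
      rw [this]; ring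
    rw [h0] at h1; simp at h1
  have hqU : q = U k := by
    unfold ev at qi qj
    have x1 : ((f i).1 * (f j).2 - (f i).2 * (f j).1) * (q.1 - (U k).1) = 0 := by
      linear_combination (f j).2 * qi - (f i).2 * qj
    have x2 : ((f i).1 * (f j).2 - (f i).2 * (f j).1) * (q.2 - (U k).2) = 0 := by
      linear_combination (f i).1 * qj - (f j).1 * qi
    simp only [mul_eq_zero, hdet, false_or] at x1 x2
    ext <;> linarith
  have hlm : 1 < l + m := by
    by_contra hc
    push Not at hc
    have e := hev (f k)
    rw [hqU, D.UU] at e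
    have y0 := mul_le_mul_of_nonneg_left (D.hf k p hp) (show 0 ≤ 1 - l - m by linarith)
    have y1 := mul_lt_mul_of_pos_left (D.ltU hkj.symm) hl0
    have y2 := mul_lt_mul_of_pos_left (D.ltU hki.symm) hm0
    linarith
  have hd : det3 (U i) (U j) (U k) = (1 - l - m) * det3 (U i) (U j) p := by
    rw [← hqU, hq]; simp [det3]; ring
  have hgp : det3 (U i) (U j) p ≠ 0 := by
    intro h0
    have hpj : U i ≠ U j := fun h => hij (D.inj h)
    have e1 : (det3 (U i) (U j) p) * ((f i).1 * (f j).2 - (f i).2 * (f j).1)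
        = -(1 - ev (f j) (U i)) * (1 - ev (f i) (U j)) := by
      have u1 := D.UU i
      have u2 := D.UU j
      have v1 : (f i).1 * ((U i).1 - p.1) + (f i).2 * ((U i).2 - p.2) = 0 := by
        unfold ev at *; linarith
      have v2 : (f j).1 * ((U j).1 - p.1) + (f j).2 * ((U j).2 - p.2) = 0 := by
        unfold ev at *; linarith
      have v3 : 1 - ev (f j) (U i) = -((f j).1 * ((U i).1 - p.1) + (f j).2 * ((U i).2 - p.2)) := by
        unfold ev at *; linarith
      have v4 : 1 - ev (f i) (U j) = -((f i).1 * ((U j).1 - p.1) + (f i).2 * ((U j).2 - p.2)) := by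
        unfold ev at *; linarith
      rw [v3, v4]
      unfold det3
      linear_combination ((f j).1 * ((U j).1 - p.1) + (f j).2 * ((U j).2 - p.2)) * v1
    rw [h0, zero_mul] at e1
    have := mul_pos ti sj
    linarith
  rw [hd]
  have := mul_self_pos.2 hgp
  nlinarith

end EdgeData

/-- The midpoints, scaled by two. -/
def UZ : Fin 10 → ℤ × ℤ :=
  ![(-1, 2), (-3, 1), (-4, 0), (-3, -1), (-1, -2), (1, -2), (3, -1), (4, 0), (3, 1), (1, 2)]

/-- Integer orientation determinant of three scaled midpoints. -/
def dZ (i j k : Fin 10) : ℤ :=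
  ((UZ j).1 - (UZ i).1) * ((UZ k).2 - (UZ i).2) - ((UZ j).2 - (UZ i).2) * ((UZ k).1 - (UZ i).1)

lemma Uv_eq (i : Fin 10) : Uv i = (((UZ i).1 : ℝ) / 2, ((UZ i).2 : ℝ) / 2) := by
  fin_cases i <;> simp [Uv, UZ] <;> norm_num

lemma det3_Uv (i j k : Fin 10) : det3 (Uv i) (Uv j) (Uv k) = (dZ i j k : ℝ) / 4 := by
  simp only [Uv_eq, det3, dZ]; push_cast; ring

lemma adj_dec : ∀ i j : Fin 10, i ≠ j → j ≠ i + 1 → i ≠ j + 1 →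
    dZ i j (i + 1) ≤ 0 ∧ 0 ≤ dZ i j (i + 9) ∧ i + 1 ≠ i ∧ i + 1 ≠ j ∧ i + 9 ≠ i ∧ i + 9 ≠ j := by
  decide

lemma UZ_inj : Function.Injective UZ := by decide

lemma Uv_inj : Function.Injective Uv := by
  intro i j h
  rw [Uv_eq, Uv_eq, Prod.mk.injEq] at h
  apply UZ_inj
  have h1 : ((UZ i).1 : ℝ) = (UZ j).1 := by linarith [h.1]
  have h2 : ((UZ i).2 : ℝ) = (UZ j).2 := by linarith [h.2]
  ext
  · exact_mod_cast h1
  · exact_mod_cast h2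

lemma D2_eq : D2 = range Uv := by
  simp only [Uv, Matrix.range_cons, Matrix.range_empty, D2]
  ext p
  simp only [mem_union, mem_singleton_iff, mem_insert_iff, mem_empty_iff_false]
  tauto

lemma adj_of {P : Set Pt} {f a b : Fin 10 → Pt} (D : EdgeData P Uv f a b) {i j : Fin 10} {p : Pt}
    (hij : i ≠ j) (hp : p ∈ P) (hi : ev (f i) p = 1) (hj : ev (f j) p = 1) :
    j = i + 1 ∨ i = j + 1 := by
  by_contra hc
  push Not at hc
  obtain ⟨d1, d2, n1, n2, n3, n4⟩ := adj_dec i j hij hc.1 hc.2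
  have s1 := D.sign hij n1 n2 hp hi hj
  have s2 := D.sign hij n3 n4 hp hi hj
  rw [det3_Uv] at s1 s2
  have d1' : ((dZ i j (i + 1) : ℤ) : ℝ) ≤ 0 := by exact_mod_cast d1
  have d2' : (0 : ℝ) ≤ (dZ i j (i + 9) : ℤ) := by exact_mod_cast d2
  rcases le_total 0 (det3 (Uv i) (Uv j) p) with h | h
  · have := mul_nonneg (div_nonneg d2' (by norm_num : (0 : ℝ) ≤ 4)) h
    linarith
  · have := mul_nonneg_of_nonpos_of_nonpos
      (div_nonpos_of_nonpos_of_nonneg d1' (by norm_num : (0 : ℝ) ≤ 4)) h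
    linarith

lemma next_vertex {P : Set Pt} {f a b : Fin 10 → Pt} (D : EdgeData P Uv f a b) (i : Fin 10) :
    ∃ p ∈ extremePoints ℝ P, ev (f i) p = 1 ∧ ev (f (i + 1)) p = 1 := by
  obtain ⟨j, hj, ej⟩ := D.other (D.ha i) (D.fa i)
  obtain ⟨k, hk, ek⟩ := D.other (D.hb i) (D.fb i)
  rcases adj_of D hj.symm (D.ha i).1 (D.fa i) ej with h | h
  · exact ⟨a i, D.ha i, D.fa i, h ▸ ej⟩
  rcases adj_of D hk.symm (D.hb i).1 (D.fb i) ek with h' | h'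
  · exact ⟨b i, D.hb i, D.fb i, h' ▸ ek⟩
  exfalso
  have hjk : j = k := by
    have := h.symm.trans h'
    exact add_right_cancel this
  subst hjk
  exact hj (D.finj (ev_unique (D.fa i) (D.fb i) ej ek (D.hab i))).symm

lemma fin_facts : ∀ i : Fin 10, i + 1 ≠ i ∧ i + 2 ≠ i ∧ i + 2 ≠ i + 1 ∧ i + 3 ≠ i ∧ i + 3 ≠ i + 1 ∧
    i + 3 ≠ i + 2 ∧ i + 4 ≠ i + 2 ∧ i + 4 ≠ i + 3 ∧ i + 1 + 1 = i + 2 ∧ i + 2 + 1 = i + 3 ∧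
    i + 3 + 1 = i + 4 := by decide

lemma part_a (P : Set Pt) (hP : IsConvexPolygon P 10) (hsym : P = -P)
    (hM : edgeMidpoints P = D2) : ∃ v ∈ Set.extremePoints ℝ P, v ∈ interior Qstar := by
  obtain ⟨hC, -, ⟨z, hz⟩, hfin, hcard, -⟩ := hP
  have h0 : (0 : Pt) ∈ interior P := by
    have hz' : -z ∈ interior P := by
      have h1 : interior P = - interior P := by
        conv_lhs => rw [hsym]
        exact ((Homeomorph.neg Pt).preimage_interior P).symm
      rw [h1]; simpa using hz
    have := hC.interior.midpoint_mem hz hz'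
    simpa [midpoint_eq_smul_add] using this
  have hed : ∀ i, ∃ a b f : Pt, IsEdgeOf P a b ∧ Uv i = midpoint ℝ a b ∧
      (∀ q ∈ P, ev f q ≤ 1) ∧ ev f a = 1 ∧ ev f b = 1 := by
    intro i
    have : Uv i ∈ edgeMidpoints P := by rw [hM, D2_eq]; exact ⟨i, rfl⟩
    obtain ⟨a, b, hab, hu⟩ := this
    obtain ⟨f, h1, h2, h3⟩ := support hC h0 hab
    exact ⟨a, b, f, hab, hu, h1, h2, h3⟩
  choose a b f hab hu hf fa fb using hed
  have D : EdgeData P Uv f a b := ⟨hfin, hcard, fun i => endpoint_extreme (hab i),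
    fun i => endpoint_extreme (edge_symm (hab i)), fun i => (hab i).1, fa, fb, hf, hu, Uv_inj⟩
  choose v vE v1 v2 using next_vertex D
  have vne : ∀ i, v i ≠ v (i + 1) := by
    intro i h
    obtain ⟨n1, n2, n3, -, -, -, -, -, m1, -⟩ := fin_facts i
    have := v2 (i + 1)
    rw [m1, ← h] at this
    rcases D.two n1.symm (v1 i) (v2 i) this with h | h
    · exact n2 h
    · exact n3 h
  have vmid : ∀ i, Uv (i + 1) = midpoint ℝ (v i) (v (i + 1)) := fun i =>
    D.mid_of (vE i) (vE (i + 1)) (vne i) (v2 i) (v1 (i + 1))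
  have turn : ∀ i, 0 < det3 (v i) (v (i + 1)) (v (i + 2)) *
      det3 (v (i + 1)) (v (i + 2)) (v (i + 3)) := by
    intro i
    obtain ⟨n1, n2, n3, n4, n5, n6, n7, n8, m1, m2, m3⟩ := fin_facts i
    have e1 : ev (f (i + 2)) (v (i + 1)) = 1 := by have := v2 (i + 1); rwa [m1] at this
    have e2 := v1 (i + 2)
    have hne := vne (i + 1)
    rw [m1] at hne
    obtain ⟨κ, hκ, h⟩ := side_lemma e1 e2 hne
    have l1 : ev (f (i + 2)) (v i) < 1 := by
      refine lt_of_le_of_ne (hf _ _ (vE i).1) ?_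
      intro h
      rcases D.two n1.symm (v1 i) (v2 i) h with h | h
      · exact n2 h
      · exact n3 h
    have l2 : ev (f (i + 2)) (v (i + 3)) < 1 := by
      refine lt_of_le_of_ne (hf _ _ (vE _).1) ?_
      intro h
      have := v2 (i + 3)
      rw [m3] at this
      rcases D.two n8.symm (v1 (i + 3)) this h with h | h
      · exact n6 h.symm
      · exact n7 h.symm
    have k1 : κ * det3 (v (i + 1)) (v (i + 2)) (v i) < 0 := by rw [← h]; linarith
    have k2 : κ * det3 (v (i + 1)) (v (i + 2)) (v (i + 3)) < 0 := by rw [← h]; linarith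
    have e : det3 (v (i + 1)) (v (i + 2)) (v i) = det3 (v i) (v (i + 1)) (v (i + 2)) := by
      unfold det3; ring
    rw [e] at k1
    have := mul_pos_of_neg_of_neg k1 k2
    have hk2 : 0 < κ * κ := mul_self_pos.2 hκ
    by_contra hc
    push Not at hc
    have := mul_nonpos_of_nonneg_of_nonpos hk2.le hc
    linarith
  refine ⟨v 9, vE 9, inQ_interior ?_⟩
  have step : ∀ i, v (i + 1) = (2 * (Uv (i + 1)).1 - (v i).1, 2 * (Uv (i + 1)).2 - (v i).2) := by
    intro i
    rw [vmid i, midpoint_eq_smul_add]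
    ext <;> simp <;> ring
  obtain ⟨x, y, hxy⟩ : ∃ x y, v 9 = (x, y) := ⟨_, _, rfl⟩
  have w0 : v 0 = (-1 - x, 2 - y) := by
    have := step 9
    rw [show (9 : Fin 10) + 1 = 0 from rfl, hxy] at this
    rw [this]; simp [Uv]; ring
  have w1 : v 1 = (x - 2, y - 1) := by
    have := step 0
    rw [show (0 : Fin 10) + 1 = 1 from rfl, w0] at this
    rw [this]; simp [Uv]; constructor <;> ring
  have w2 : v 2 = (-2 - x, 1 - y) := by
    have := step 1
    rw [show (1 : Fin 10) + 1 = 2 from rfl, w1] at this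
    rw [this]; simp [Uv]; ring
  have w3 : v 3 = (x - 1, y - 2) := by
    have := step 2
    rw [show (2 : Fin 10) + 1 = 3 from rfl, w2] at this
    rw [this]; simp [Uv]; constructor <;> ring
  have w4 : v 4 = (-x, -y) := by
    have := step 3
    rw [show (3 : Fin 10) + 1 = 4 from rfl, w3] at this
    rw [this]; simp [Uv]; constructor <;> ring
  have w5 : v 5 = (1 + x, y - 2) := by
    have := step 4
    rw [show (4 : Fin 10) + 1 = 5 from rfl, w4] at this
    rw [this]; simp [Uv]; ring
  have t9 := turn 9
  have t0 := turn 0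
  have t1 := turn 1
  have t2 := turn 2
  rw [show (9 : Fin 10) + 1 = 0 from rfl, show (9 : Fin 10) + 2 = 1 from rfl,
    show (9 : Fin 10) + 3 = 2 from rfl] at t9
  rw [show (0 : Fin 10) + 1 = 1 from rfl, show (0 : Fin 10) + 2 = 2 from rfl,
    show (0 : Fin 10) + 3 = 3 from rfl] at t0
  rw [show (1 : Fin 10) + 1 = 2 from rfl, show (1 : Fin 10) + 2 = 3 from rfl,
    show (1 : Fin 10) + 3 = 4 from rfl] at t1
  rw [show (2 : Fin 10) + 1 = 3 from rfl, show (2 : Fin 10) + 2 = 4 from rfl,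
    show (2 : Fin 10) + 3 = 5 from rfl] at t2
  have d9 : det3 (v 9) (v 0) (v 1) = 5 - 4 * y + 2 * x := by
    rw [hxy, w0, w1]; simp [det3]; ring
  have d0 : det3 (v 0) (v 1) (v 2) = 2 * y - 2 * x - 2 := by
    rw [w0, w1, w2]; simp [det3]; ring
  have d1 : det3 (v 1) (v 2) (v 3) = 2 * y + 2 * x - 2 := by
    rw [w1, w2, w3]; simp [det3]; ring
  have d2 : det3 (v 2) (v 3) (v 4) = 5 - 4 * y - 2 * x := by
    rw [w2, w3, w4]; simp [det3]; ring
  have d3 : det3 (v 3) (v 4) (v 5) = 4 * (y - 1) := by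
    rw [w3, w4, w5]; simp [det3]; ring
  rw [d9, d0] at t9
  rw [d0, d1] at t0
  rw [d1, d2] at t1
  rw [d2, d3] at t2
  rw [hxy]
  simp only [InQ]
  rw [mul_pos_iff] at t9 t0 t1 t2
  rcases t9 with ⟨p1, p2⟩ | ⟨p1, p2⟩ <;> rcases t0 with ⟨p3, p4⟩ | ⟨p3, p4⟩ <;>
  rcases t1 with ⟨p5, p6⟩ | ⟨p5, p6⟩ <;> rcases t2 with ⟨p7, p8⟩ | ⟨p7, p8⟩ <;>
  refine ⟨?_, ?_, ?_, ?_⟩ <;> linarith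

/-- (a) every centrally symmetric convex decagon centered at the origin with edge
midpoint set `D₂` has a vertex in the interior of `Q*`; (b) every point of the interior of `Q*`
is a vertex of such a decagon. -/
theorem decagonD2_vertex_in_Qstar :
    (∀ P : Set Pt, IsConvexPolygon P 10 → P = -P → edgeMidpoints P = D2 →
      ∃ v ∈ Set.extremePoints ℝ P, v ∈ interior Qstar) ∧
    (∀ v ∈ interior Qstar, ∃ P : Set Pt, IsConvexPolygon P 10 ∧ P = -P ∧
      edgeMidpoints P = D2 ∧ v ∈ Set.extremePoints ℝ P) := by
  exact ⟨part_a, part_b⟩
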